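/- Let T > 0, let p ≥ 1, and for n = 1, …, p let x_n ∈ ℝ, y_n ∈ (0, T/2) and σ_n ∈ ℝ. For x ∈ ℝ define G(x) = Σ_{n=1}^{p} 2σ_n · L_n(x), where L_n(x) is the limit as M → ∞ of the symmetric partial sums Σ_{N=−M}^{M} (y_n + N T)/((x − x_n)² + (y_n + N T)²). Then ∫_{−∞}^{∞} G(x) dx = Σ_{n=1}^{p} 2σ_n (π − 2π y_n / T) = (4π/T) Σ_{n=1}^{p} σ_n (T/2 − y_n). -/

import Mathlib

open MeasureTheory

lemma aux_tanh_top : Filter.Tendsto (fun b : ℝ => Real.sinh b / Real.cosh b) Filter.atTop (nhds 1) := by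
  have h : (fun b : ℝ => Real.sinh b / Real.cosh b) =
      fun b => (1 - Real.exp (-b) * Real.exp (-b)) / (1 + Real.exp (-b) * Real.exp (-b)) := by
    funext b
    have h1 : Real.exp (-b) * Real.exp b = 1 := by rw [← Real.exp_add]; simp
    have hp := Real.exp_pos b
    have hn := Real.exp_pos (-b)
    rw [Real.sinh_eq, Real.cosh_eq, div_eq_div_iff (by positivity) (by positivity)]
    linear_combination Real.exp (-b) * h1
  rw [h]
  have e : Filter.Tendsto (fun b : ℝ => Real.exp (-b)) Filter.atTop (nhds 0) :=
    Real.tendsto_exp_neg_atTop_nhds_zero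
  have := ((e.mul e).const_sub 1).div ((e.mul e).const_add 1) (by norm_num)
  simp only [mul_zero, sub_zero, add_zero, div_one] at this
  exact this

lemma aux_tanh_bot :
    Filter.Tendsto (fun b : ℝ => Real.sinh b / Real.cosh b) Filter.atBot (nhds (-1)) := by
  have := (aux_tanh_top.comp Filter.tendsto_neg_atBot_atTop).neg
  refine this.congr fun b => ?_
  simp [neg_div]

lemma aux_den_pos (a b : ℝ) (ha : 0 < Real.sin a) :
    0 < Real.sin a ^ 2 * Real.cosh b ^ 2 + Real.cos a ^ 2 * Real.sinh b ^ 2 := by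
  have := Real.cosh_pos b
  positivity

lemma aux_deriv (a k u : ℝ) (ha : 0 < Real.sin a) :
    HasDerivAt (fun u : ℝ => Real.arctan (Real.cos a / Real.sin a *
        (Real.sinh (k * u) / Real.cosh (k * u))))
      (k * (Real.sin a * Real.cos a /
        (Real.sin a ^ 2 * Real.cosh (k * u) ^ 2 + Real.cos a ^ 2 * Real.sinh (k * u) ^ 2))) u := by
  have hk : HasDerivAt (fun u : ℝ => k * u) k u := by
    simpa using (hasDerivAt_id u).const_mul k
  have hc := Real.cosh_pos (k * u)
  have h := (((hk.sinh.div hk.cosh hc.ne').const_mul (Real.cos a / Real.sin a)).arctan)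
  refine h.congr_deriv ?_
  have hd := aux_den_pos a (k * u) ha
  have h2 : 1 + (Real.cos a / Real.sin a * (Real.sinh (k * u) / Real.cosh (k * u))) ^ 2 =
    (Real.sin a ^ 2 * Real.cosh (k * u) ^ 2 + Real.cos a ^ 2 * Real.sinh (k * u) ^ 2) /
      (Real.sin a ^ 2 * Real.cosh (k * u) ^ 2) := by
    field_simp
  have h3 := Real.cosh_sq (k * u)
  simp only [Pi.div_apply]
  rw [h2]
  field_simp
  rw [h3]
  ring

lemma aux_integral (a k : ℝ) (ha : 0 < a) (ha' : a < Real.pi / 2) (hk : 0 < k) :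
    Integrable (fun u : ℝ => k * (Real.sin a * Real.cos a /
        (Real.sin a ^ 2 * Real.cosh (k * u) ^ 2 + Real.cos a ^ 2 * Real.sinh (k * u) ^ 2))) ∧
    ∫ u : ℝ, k * (Real.sin a * Real.cos a /
        (Real.sin a ^ 2 * Real.cosh (k * u) ^ 2 + Real.cos a ^ 2 * Real.sinh (k * u) ^ 2))
      = Real.pi - 2 * a := by
  have hs : 0 < Real.sin a := Real.sin_pos_of_pos_of_lt_pi ha (by linarith [Real.pi_pos])
  have hco : 0 < Real.cos a := Real.cos_pos_of_mem_Ioo ⟨by linarith, ha'⟩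
  have hF := fun u => aux_deriv a k u hs
  have hat : Real.arctan (Real.cos a / Real.sin a) = Real.pi / 2 - a := by
    have : Real.cos a / Real.sin a = Real.tan (Real.pi / 2 - a) := by
      rw [Real.tan_pi_div_two_sub, Real.tan_eq_sin_div_cos, inv_div]
    rw [this, Real.arctan_tan] <;> linarith
  have ht := (Real.continuous_arctan.tendsto _).comp
    ((aux_tanh_top.comp (Filter.tendsto_id.const_mul_atTop hk)).const_mul
      (Real.cos a / Real.sin a))
  have hb := (Real.continuous_arctan.tendsto _).comp
    ((aux_tanh_bot.comp (Filter.tendsto_id.const_mul_atBot hk)).const_mul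
      (Real.cos a / Real.sin a))
  rw [mul_one, hat] at ht
  rw [mul_neg_one, Real.arctan_neg, hat] at hb
  have hcont : Continuous (fun u : ℝ => k * (Real.sin a * Real.cos a /
        (Real.sin a ^ 2 * Real.cosh (k * u) ^ 2 + Real.cos a ^ 2 * Real.sinh (k * u) ^ 2))) := by
    refine continuous_const.mul (continuous_const.div ?_ fun u => (aux_den_pos a _ hs).ne')
    have h1 : Continuous fun u : ℝ => Real.cosh (k * u) :=
      Real.continuous_cosh.comp (continuous_const.mul continuous_id)
    have h2 : Continuous fun u : ℝ => Real.sinh (k * u) :=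
      Real.continuous_sinh.comp (continuous_const.mul continuous_id)
    exact (continuous_const.mul (h1.pow 2)).add (continuous_const.mul (h2.pow 2))
  have hint : Integrable (fun u : ℝ => k * (Real.sin a * Real.cos a /
        (Real.sin a ^ 2 * Real.cosh (k * u) ^ 2 + Real.cos a ^ 2 * Real.sinh (k * u) ^ 2))) := by
    refine integrable_of_intervalIntegral_norm_tendsto (l := Filter.atTop) (a := fun i : ℝ => -i)
      (b := fun i : ℝ => i) ((Real.pi / 2 - a) - -(Real.pi / 2 - a))
      (fun i => (hcont.integrableOn_Icc).mono_set Set.Ioc_subset_Icc_self)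
      Filter.tendsto_neg_atTop_atBot Filter.tendsto_id ?_
    refine (ht.sub (hb.comp Filter.tendsto_neg_atTop_atBot)).congr fun i => ?_
    symm
    have : ∀ u : ℝ, ‖k * (Real.sin a * Real.cos a /
        (Real.sin a ^ 2 * Real.cosh (k * u) ^ 2 + Real.cos a ^ 2 * Real.sinh (k * u) ^ 2))‖ =
        k * (Real.sin a * Real.cos a /
        (Real.sin a ^ 2 * Real.cosh (k * u) ^ 2 + Real.cos a ^ 2 * Real.sinh (k * u) ^ 2)) := by
      intro u
      have := aux_den_pos a (k * u) hs
      exact Real.norm_of_nonneg (by positivity)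
    simp_rw [this]
    rw [intervalIntegral.integral_eq_sub_of_hasDerivAt (fun u _ => hF u)
      (hcont.intervalIntegrable _ _)]
    rfl
  refine ⟨hint, ?_⟩
  rw [integral_of_hasDerivAt_of_tendsto hF hint hb ht]
  ring

lemma aux_cot_re (a b : ℝ) (ha : 0 < Real.sin a) :
    (Complex.cot (a + b * Complex.I)).re = Real.sin a * Real.cos a /
        (Real.sin a ^ 2 * Real.cosh b ^ 2 + Real.cos a ^ 2 * Real.sinh b ^ 2) := by
  have hd := aux_den_pos a b ha
  have h3 := Real.cosh_sq b
  rw [Complex.cot, Complex.cos_add_mul_I, Complex.sin_add_mul_I, ← Complex.ofReal_sin,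
    ← Complex.ofReal_cos, ← Complex.ofReal_cosh, ← Complex.ofReal_sinh, Complex.div_re]
  simp [Complex.normSq_apply, -Complex.ofReal_sin, -Complex.ofReal_cos, -Complex.ofReal_cosh,
    -Complex.ofReal_sinh]
  rw [← add_div]
  have e : Real.sin a * Real.cosh b * (Real.sin a * Real.cosh b) +
    Real.cos a * Real.sinh b * (Real.cos a * Real.sinh b) =
    (Real.sin a ^ 2 * Real.cosh b ^ 2 + Real.cos a ^ 2 * Real.sinh b ^ 2) := by ring
  rw [e]
  congr 1
  linear_combination Real.sin a * Real.cos a * h3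

lemma aux_sum (f : ℤ → ℝ) (M : ℕ) : ∑ N ∈ Finset.Icc (-(M : ℤ)) (M : ℤ), f N =
    f 0 + ∑ j ∈ Finset.range M, (f (-((j : ℤ) + 1)) + f ((j : ℤ) + 1)) := by
  induction M with
  | zero => simp
  | succ m ih =>
    have := Finset.sum_Icc_succ_eq_add_endpoints f (N := m)
    push_cast at this ⊢
    rw [this, ih, Finset.sum_range_succ]
    ring

lemma aux_inv_re (T y u : ℝ) (hT : 0 < T) (N : ℝ) :
    (1 / (((y / T : ℝ) : ℂ) + ((u / T : ℝ) : ℂ) * Complex.I + (N : ℂ))).re =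
      T * ((y + N * T) / (u ^ 2 + (y + N * T) ^ 2)) := by
  have h1 : (y / T + N) = (y + N * T) / T := by field_simp
  rw [one_div, Complex.inv_re, Complex.normSq_apply]
  simp
  rw [h1]
  by_cases h : u ^ 2 + (y + N * T) ^ 2 = 0
  · have h5 : y + N * T = 0 := by nlinarith [sq_nonneg u, sq_nonneg (y + N * T)]
    simp [h5]
  · have : (y + N * T) / T * ((y + N * T) / T) + u / T * (u / T) =
      (u ^ 2 + (y + N * T) ^ 2) / T ^ 2 := by field_simp; ring
    rw [this]
    field_simp

lemma aux_L (T y u l : ℝ) (hT : 0 < T) (hy : y ∈ Set.Ioo 0 (T / 2))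
    (hl : Filter.Tendsto
      (fun M : ℕ => ∑ N ∈ Finset.Icc (-(M : ℤ)) (M : ℤ),
        (y + (N : ℝ) * T) / (u ^ 2 + (y + (N : ℝ) * T) ^ 2)) Filter.atTop (nhds l)) :
    l = Real.pi / T * (Real.sin (Real.pi * y / T) * Real.cos (Real.pi * y / T) /
        (Real.sin (Real.pi * y / T) ^ 2 * Real.cosh (Real.pi / T * u) ^ 2 +
          Real.cos (Real.pi * y / T) ^ 2 * Real.sinh (Real.pi / T * u) ^ 2)) := by
  obtain ⟨hy0, hy1⟩ := hy
  have hyT : y / T < 1 / 2 := by rw [div_lt_iff₀ hT]; linarith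
  have hyT0 : 0 < y / T := by positivity
  have hs : 0 < Real.sin (Real.pi * y / T) := by
    rw [mul_div_assoc]
    exact Real.sin_pos_of_pos_of_lt_pi (by positivity) (by nlinarith [Real.pi_pos])
  set z : ℂ := ((y / T : ℝ) : ℂ) + ((u / T : ℝ) : ℂ) * Complex.I with hz
  have hzc : z ∈ Complex.integerComplement := by
    rintro ⟨n, hn⟩
    have h := congrArg Complex.re hn
    simp [hz, -Complex.ofReal_div] at h
    rw [← h] at hyT hyT0
    have h1 : (0 : ℤ) < n := by exact_mod_cast hyT0
    have h2 : (n : ℝ) < 1 := by linarith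
    have h3 : n < 1 := by exact_mod_cast h2
    omega
  have ht := (Complex.continuous_re.tendsto _).comp (tendsto_logDeriv_euler_cot_sub hzc)
  have ht2 := (ht.const_add (1 / z).re).const_mul (1 / T)
  have key : l = 1 / T * ((1 / z).re + (Real.pi * Complex.cot (Real.pi * z) - 1 / z).re) := by
    refine tendsto_nhds_unique hl (ht2.congr fun M => ?_)
    rw [aux_sum]
    have h0 := aux_inv_re T y u hT 0
    simp only [Function.comp, Complex.re_sum, cotTerm, Complex.add_re (1 / _) (1 / _)]
    rw [← hz] at h0
    simp only [Complex.ofReal_zero, add_zero] at h0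
    rw [h0, mul_add, Finset.mul_sum]
    congr 1
    · push_cast; field_simp
    · refine Finset.sum_congr rfl fun j _ => ?_
      have h1 := aux_inv_re T y u hT (-((j : ℝ) + 1))
      have h2 := aux_inv_re T y u hT ((j : ℝ) + 1)
      rw [← hz] at h1 h2
      push_cast at h1 h2 ⊢
      rw [sub_eq_add_neg, h1, h2]
      field_simp
  rw [key, Complex.sub_re, Complex.re_ofReal_mul]
  have e : (Real.pi : ℂ) * z =
      ((Real.pi * y / T : ℝ) : ℂ) + ((Real.pi / T * u : ℝ) : ℂ) * Complex.I := by
    rw [hz]; push_cast; ring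
  rw [e, aux_cot_re _ _ hs]
  ring



/-- Eq. (A5): the soliton phase shift. For virtual monopoles in conjugate pairs
at x_n ± i y_n (charges ±σ_n), repeated with period T, the line integral of
G(x) = Σ_n 2σ_n L_n(x) — where L_n(x) is the principal-value lattice sum —
equals Σ_n 2σ_n(π − 2πy_n/T) = (4π/T) Σ_n σ_n(T/2 − y_n). -/
theorem stmt_7 (T : ℝ) (hT : 0 < T) (p : ℕ) (hp : 1 ≤ p)
    (x y σ : Fin p → ℝ) (hy : ∀ n, y n ∈ Set.Ioo 0 (T / 2))
    (L : Fin p → ℝ → ℝ)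
    (hL : ∀ (n : Fin p) (x' : ℝ), Filter.Tendsto
      (fun M : ℕ => ∑ N ∈ Finset.Icc (-(M : ℤ)) (M : ℤ),
        (y n + (N : ℝ) * T) / ((x' - x n) ^ 2 + (y n + (N : ℝ) * T) ^ 2))
      Filter.atTop (nhds (L n x'))) :
    (∫ x' : ℝ, ∑ n : Fin p, 2 * σ n * L n x') =
        ∑ n : Fin p, 2 * σ n * (Real.pi - 2 * Real.pi * y n / T) ∧
    (∑ n : Fin p, 2 * σ n * (Real.pi - 2 * Real.pi * y n / T)) =
        (4 * Real.pi / T) * ∑ n : Fin p, σ n * (T / 2 - y n) := by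
  refine ⟨?_, ?_⟩
  · have hLeq : ∀ n, L n = fun x' => (fun u : ℝ => Real.pi / T *
        (Real.sin (Real.pi * y n / T) * Real.cos (Real.pi * y n / T) /
        (Real.sin (Real.pi * y n / T) ^ 2 * Real.cosh (Real.pi / T * u) ^ 2 +
          Real.cos (Real.pi * y n / T) ^ 2 * Real.sinh (Real.pi / T * u) ^ 2))) (x' - x n) := by
      intro n
      funext x'
      exact aux_L T (y n) (x' - x n) _ hT (hy n) (hL n x')
    have hI : ∀ n, Integrable (L n) ∧ ∫ x', L n x' = Real.pi - 2 * Real.pi * y n / T := by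
      intro n
      obtain ⟨hy0, hy1⟩ := hy n
      have hpi := Real.pi_pos
      have h := aux_integral (Real.pi * y n / T) (Real.pi / T) (by positivity)
        (by rw [div_lt_iff₀ hT]; nlinarith) (by positivity)
      rw [hLeq n]
      refine ⟨h.1.comp_sub_right (x n), ?_⟩
      rw [integral_sub_right_eq_self (μ := volume) _ (x n), h.2]
      ring
    rw [integral_finsetSum _ fun n _ => (hI n).1.const_mul _]
    refine Finset.sum_congr rfl fun n _ => ?_
    rw [integral_const_mul, (hI n).2]
  · rw [Finset.mul_sum]
    refine Finset.sum_congr rfl fun n _ => ?_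
    field_simp
    ring
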